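/- Let P be the Pell sequence (P_0 = 0, P_1 = 1, P_n = 2P_{n-1} + P_{n-2}), Q the associated Pell sequence (Q_0 = 1, Q_1 = 1, Q_n = 2Q_{n-1} + Q_{n-2}), and C the Lucas-balancing sequence (C_0 = 1, C_1 = 3, C_n = 6C_{n-1} − C_{n-2}). Define σ_C(k,n) = Σ_{i=1}^{k} C_{n+i}. For all k ≥ 1 and all n ≥ 0: 2·σ_C(k,n) = Q_{2k+2n+1} − Q_{2n+1}; moreover if k is even then σ_C(k,n) = 2·P_k·P_{k+2n+1}, and if k is odd then σ_C(k,n) = Q_k·Q_{k+2n+1}. -/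

import Mathlib

/-- The Pell sequence: P₀ = 0, P₁ = 1, Pₙ = 2Pₙ₋₁ + Pₙ₋₂. -/
def pell : ℕ → ℤ
  | 0 => 0
  | 1 => 1
  | n + 2 => 2 * pell (n + 1) + pell n

/-- The associated Pell sequence: Q₀ = 1, Q₁ = 1, Qₙ = 2Qₙ₋₁ + Qₙ₋₂. -/
def assocPell : ℕ → ℤ
  | 0 => 1
  | 1 => 1
  | n + 2 => 2 * assocPell (n + 1) + assocPell n

/-- The Lucas-balancing sequence: C₀ = 1, C₁ = 3, Cₙ = 6Cₙ₋₁ − Cₙ₋₂. -/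
def lucasBalancing : ℕ → ℤ
  | 0 => 1
  | 1 => 3
  | n + 2 => 6 * lucasBalancing (n + 1) - lucasBalancing n

theorem pell_succ_and_assocPell_succ (n : ℕ) :
    pell (n + 1) = pell n + assocPell n ∧ assocPell (n + 1) = assocPell n + 2 * pell n := by
  induction n with
  | zero => simp [pell, assocPell]
  | succ n ih =>
    obtain ⟨hP, hQ⟩ := ih
    rw [pell, assocPell]
    constructor <;> linarith

theorem pell_succ (n : ℕ) : pell (n + 1) = pell n + assocPell n :=
  (pell_succ_and_assocPell_succ n).1

theorem assocPell_succ (n : ℕ) : assocPell (n + 1) = assocPell n + 2 * pell n :=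
  (pell_succ_and_assocPell_succ n).2

theorem pell_add_and_assocPell_add (m k : ℕ) :
    pell (m + k) = pell m * assocPell k + assocPell m * pell k ∧
    assocPell (m + k) = assocPell m * assocPell k + 2 * pell m * pell k := by
  induction k with
  | zero => simp [pell, assocPell]
  | succ k ih =>
    obtain ⟨hP, hQ⟩ := ih
    rw [← add_assoc, pell_succ (m + k), assocPell_succ (m + k), pell_succ k, assocPell_succ k,
      hP, hQ]
    constructor <;> ring

theorem pell_add (m k : ℕ) :
    pell (m + k) = pell m * assocPell k + assocPell m * pell k :=
  (pell_add_and_assocPell_add m k).1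

theorem assocPell_add (m k : ℕ) :
    assocPell (m + k) = assocPell m * assocPell k + 2 * pell m * pell k :=
  (pell_add_and_assocPell_add m k).2

theorem assocPell_sq_sub (k : ℕ) : assocPell k ^ 2 - 2 * pell k ^ 2 = (-1) ^ k := by
  induction k with
  | zero => simp [pell, assocPell]
  | succ k ih =>
    rw [pell_succ, assocPell_succ, pow_succ (-1), ← ih]
    ring

theorem assocPell_add_four (n : ℕ) :
    assocPell (n + 4) = 6 * assocPell (n + 2) - assocPell n := by
  simp only [assocPell]
  ring

theorem lucasBalancing_eq_assocPell (n : ℕ) : lucasBalancing n = assocPell (2 * n) := by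
  induction n using Nat.twoStepInduction with
  | zero => rfl
  | one => simp [lucasBalancing, assocPell]
  | more n ih₀ ih₁ =>
    rw [lucasBalancing, ih₀, ih₁, show 2 * (n + 2) = 2 * n + 4 by ring, assocPell_add_four,
      mul_add_one]

theorem two_mul_sum_lucasBalancing (k n : ℕ) :
    2 * (∑ i ∈ Finset.Icc 1 k, lucasBalancing (n + i)) =
      assocPell (2 * k + 2 * n + 1) - assocPell (2 * n + 1) := by
  induction k with
  | zero => simp
  | succ k ih =>
    rw [Finset.sum_Icc_succ_top (by omega), mul_add, ih, lucasBalancing_eq_assocPell,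
      show 2 * (k + 1) + 2 * n + 1 = 2 * k + 2 * n + 1 + 2 by ring, assocPell,
      show 2 * (n + (k + 1)) = 2 * k + 2 * n + 1 + 1 by ring]
    ring

theorem sigma_lucasBalancing (k n : ℕ) (hk : 1 ≤ k) :
    2 * (∑ i ∈ Finset.Icc 1 k, lucasBalancing (n + i)) =
      assocPell (2 * k + 2 * n + 1) - assocPell (2 * n + 1) ∧
    (Even k →
      ∑ i ∈ Finset.Icc 1 k, lucasBalancing (n + i) = 2 * pell k * pell (k + 2 * n + 1)) ∧
    (Odd k →
      ∑ i ∈ Finset.Icc 1 k, lucasBalancing (n + i) = assocPell k * assocPell (k + 2 * n + 1)) := by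
  have hsum := two_mul_sum_lucasBalancing k n
  have hnorm := assocPell_sq_sub k
  have hm : k + 2 * n + 1 = 2 * n + 1 + k := by ring
  have hdouble : 2 * k + 2 * n + 1 = 2 * n + 1 + k + k := by ring
  refine ⟨hsum, fun hk => ?_, fun hk => ?_⟩
  · rw [hk.neg_one_pow] at hnorm
    rw [hdouble, assocPell_add _ k, assocPell_add _ k, pell_add _ k] at hsum
    rw [hm, pell_add _ k]
    refine mul_left_cancel₀ (two_ne_zero (α := ℤ)) ?_
    linear_combination hsum + assocPell (2 * n + 1) * hnorm
  · rw [hk.neg_one_pow] at hnorm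
    rw [hdouble, assocPell_add _ k, assocPell_add _ k, pell_add _ k] at hsum
    rw [hm, assocPell_add _ k]
    refine mul_left_cancel₀ (two_ne_zero (α := ℤ)) ?_
    linear_combination hsum - assocPell (2 * n + 1) * hnorm
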